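/- Even for constructive τ, an approximate abstraction need not decompose as an approximation of an exact abstraction: let (M_L, I_L) be the recursive model with U_L = {U}, V_L = {X_1, X_2, X_3}, R(X_i) = {0,1}, equations X_1 = U, X_2 = X_1, X_3 = X_2, and I_L the set of all interventions in which X_1 is intervened on iff X_3 is intervened on; let (M_H, I_H) have U_H = {U}, V_H = {Y_1, Y_2}, R(Y_1) = {0,1} × {0,1}, R(Y_2) = {0,1}, equations Y_1 = (U, U) and Y_2 = the first component of Y_1, and I_H all interventions; let τ(x_1, x_2, x_3) = ((x_1, x_3), x_2), which is constructive for the partition {{X_1, X_3}, {X_2}}. Then (M_H, I_H) and (M_L, I_L) are τ-consistent, (M_H, I_H) is a τ-α-approximate abstraction of (M_L, I_L) for some α (depending on the chosen metric d_{V_H}), yet there exists NO recursive causal model (M_H', I_H) similar to (M_H, I_H) that is an exact τ-abstraction of (M_L, I_L). -/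

import Mathlib

open Classical

/-- An intervention `X ← x`, as a partial assignment of values to the
endogenous variables. -/
abbrev Intervention (V : Type) (R : V → Type) : Type := ∀ v : V, Option (R v)

/-- `Rst i` is the set of endogenous states that agree with intervention `i`
on all intervened variables. -/
def Rst {V : Type} {R : V → Type} (i : Intervention V R) : Set (∀ v, R v) :=
  {s | ∀ (v : V) (a : R v), i v = some a → s v = a}

/-- `g` depends on variable `w` if changing only the value of `w` can change
the value of `g`. -/
def DependsOnVar {V : Type} {R : V → Type} {A : Type}
    (g : (∀ v, R v) → A) (w : V) : Prop :=
  ∃ s s' : ∀ v, R v, (∀ z, z ≠ w → s z = s' z) ∧ g s ≠ g s'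

/-- A structural causal model: each endogenous variable has a structural
equation. -/
structure SCM (Ctx V : Type) (R : V → Type) where
  F : ∀ v : V, Ctx → (∀ w, R w) → R v

/-- Recursiveness: for each context there is a strict partial order `≺` on the
endogenous variables such that the equation of `v` depends on `w` only if
`w ≺ v`. -/
def SCM.Recursive {Ctx V : Type} {R : V → Type} (M : SCM Ctx V R) : Prop :=
  ∀ u : Ctx, ∃ ord : V → V → Prop, IsStrictOrder V ord ∧
    ∀ v w : V, DependsOnVar (M.F v u) w → ord w v

/-- `s` is a solution of model `M` in context `u` under intervention `i`. -/
def IsSolution {Ctx V : Type} {R : V → Type} (M : SCM Ctx V R) (u : Ctx)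
    (i : Intervention V R) (s : ∀ v, R v) : Prop :=
  ∀ v : V, s v = (i v).getD (M.F v u s)

/-- `τ` is constructive: the low-level variables can be partitioned into
cells, one (nonempty) cell `π⁻¹(some y)` for each high-level variable `y`
plus a (possibly empty) marginalized cell `π⁻¹(none)`, such that the `y`
component of `τ` only depends on the values of the variables in the cell of
`y`, via a map `τ_y`. -/
def Constructive {VL VH : Type} {RL : VL → Type} {RH : VH → Type}
    (τ : (∀ v, RL v) → (∀ v, RH v)) : Prop :=
  ∃ π : VL → Option VH,
    (∀ y : VH, ∃ v : VL, π v = some y) ∧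
    ∃ τs : ∀ y : VH, (((v : {v : VL // π v = some y}) → RL v.1) → RH y),
      ∀ (s : ∀ v, RL v) (y : VH), τ s y = τs y (fun v => s v.1)

/-- The distance `d_τ(M_L, M_H)`. -/
noncomputable def dTau {CtxL CtxH VL VH : Type} {RL : VL → Type} {RH : VH → Type}
    (dH : (∀ v, RH v) → (∀ v, RH v) → ℝ)
    (τ : (∀ v, RL v) → (∀ v, RH v))
    (ω : Intervention VL RL → Intervention VH RH)
    (IL : Set (Intervention VL RL))
    (ML : CtxL → Intervention VL RL → (∀ v, RL v))
    (MH : CtxH → Intervention VH RH → (∀ v, RH v)) : ℝ :=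
  sInf {a | ∃ τU : CtxL → CtxH, Function.Surjective τU ∧
      a = sSup {b | ∃ i ∈ IL, ∃ u : CtxL,
            b = dH (τ (ML u i)) (MH (τU u) (ω i))}}

/- The concrete example: `U_L = {U}` with `R(U) = {0,1}` (contexts `Bool`);
low-level binary variables `X₁, X₂, X₃` (`VL = Fin 3`); equations `X₁ = U`,
`X₂ = X₁`, `X₃ = X₂`; `I_L` the interventions in which `X₁` is intervened on
iff `X₃` is; high-level variables `Y₁` (range `Bool × Bool`) and `Y₂` (range
`Bool`); equations `Y₁ = (U, U)` and `Y₂ = fst Y₁`; `I_H` all interventions;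
`τ(x₁, x₂, x₃) = ((x₁, x₃), x₂)`. -/

namespace Example12

abbrev VL := Fin 3
abbrev RL : VL → Type := fun _ => Bool
abbrev CtxL := Bool
abbrev CtxH := Bool

inductive VH : Type
  | Y1 : VH
  | Y2 : VH
deriving DecidableEq

def RH : VH → Type
  | .Y1 => Bool × Bool
  | .Y2 => Bool

instance : ∀ y : VH, Fintype (RH y) := fun y => by cases y <;> dsimp [RH] <;> infer_instance
instance : ∀ y : VH, Nonempty (RH y) := fun y => by cases y <;> dsimp [RH] <;> infer_instance

instance : Fintype VH :=
  ⟨{VH.Y1, VH.Y2}, fun y => by cases y <;> simp⟩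

/-- `τ(x₁, x₂, x₃) = ((x₁, x₃), x₂)`. -/
def τ (s : ∀ v : VL, RL v) : ∀ y : VH, RH y
  | .Y1 => (s 0, s 2)
  | .Y2 => s 1

/-- The low-level model: `X₁ = U`, `X₂ = X₁`, `X₃ = X₂`. -/
def FL : SCM CtxL VL RL :=
  ⟨fun v u s =>
    match v with
    | 0 => u
    | 1 => s 0
    | 2 => s 1⟩

/-- The semantics of the low-level model. -/
def ML : CtxL → Intervention VL RL → (∀ v : VL, RL v) :=
  fun u i =>
    let x1 := (i 0).getD u
    let x2 := (i 1).getD x1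
    let x3 := (i 2).getD x2
    ![x1, x2, x3]

/-- `I_L`: all interventions in which `X₁` is intervened on iff `X₃` is. -/
def IL : Set (Intervention VL RL) := {i | (i 0).isSome = (i 2).isSome}

/-- The high-level model: `Y₁ = (U, U)`, `Y₂ = fst Y₁`. -/
def FH : SCM CtxH VH RH :=
  ⟨fun v u s =>
    match v with
    | .Y1 => (u, u)
    | .Y2 => (s .Y1).1⟩

/-- The semantics of the high-level model. -/
def MH (u : CtxH) (i : Intervention VH RH) : ∀ y : VH, RH y
  | .Y1 => (i .Y1).getD (u, u)
  | .Y2 => (i .Y2).getD ((i .Y1).getD (u, u)).1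

/-- `I_H`: all high-level interventions. -/
def IH : Set (Intervention VH RH) := Set.univ

/-- The induced map `ω_τ` on interventions:
`ω_τ(X₁ ← a, X₃ ← c, …) = (Y₁ ← (a, c), …)` and `ω_τ(X₂ ← b) = (Y₂ ← b)`. -/
def ω (i : Intervention VL RL) : Intervention VH RH := fun y =>
  match y with
  | .Y1 =>
      match i 0, i 2 with
      | some a, some c => some (a, c)
      | _, _ => none
  | .Y2 => i 1

def mkH (a : Bool × Bool) (b : Bool) : ∀ y : VH, RH y
  | .Y1 => a
  | .Y2 => b

theorem eq_mkH (s : ∀ y : VH, RH y) : s = mkH (s .Y1) (s .Y2) := by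
  funext y; cases y <;> rfl

/-- If two states give different values, the function depends on some variable. -/
theorem depends_of_ne {A : Type} (g : (∀ y : VH, RH y) → A) (a a' : Bool × Bool) (b b' : Bool)
    (h : g (mkH a b) ≠ g (mkH a' b')) : DependsOnVar g .Y1 ∨ DependsOnVar g .Y2 := by
  by_cases h1 : g (mkH a b) = g (mkH a' b)
  · right
    refine ⟨mkH a' b, mkH a' b', ?_, fun e => h (h1.trans e)⟩
    intro z hz
    cases z
    · rfl
    · exact absurd rfl hz
  · left
    refine ⟨mkH a b, mkH a' b, ?_, h1⟩
    intro z hz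
    cases z
    · exact absurd rfl hz
    · rfl

theorem no_exact : ¬ ∃ (FH' : SCM CtxH VH RH)
        (MH' : CtxH → Intervention VH RH → (∀ y : VH, RH y)),
          FH'.Recursive ∧
          (∀ u i, IsSolution FH' u i (MH' u i)) ∧
          ∃ τU : CtxL → CtxH, Function.Surjective τU ∧
            ∀ u : CtxL, ∀ i ∈ IL, τ (ML u i) = MH' (τU u) (ω i) := by
  rintro ⟨F, M, hrec, hsol, t, -, h⟩
  obtain ⟨ord, hord, hdep⟩ := hrec (t false)
  have key1 : ∀ b : Bool, F.F .Y1 (t false) (mkH (false, b) b) = (false, b) := by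
    intro b
    have e := h false ![none, some b, none] rfl
    have hs := hsol (t false) (ω ![none, some b, none]) .Y1
    rw [← e, eq_mkH (τ _)] at hs
    exact hs.symm
  have key2 : ∀ a : Bool, F.F .Y2 (t false) (mkH (a, false) a) = a := by
    intro b
    have e := h false ![some b, none, some false] rfl
    have hs := hsol (t false) (ω ![some b, none, some false]) .Y2
    rw [← e, eq_mkH (τ _)] at hs
    exact hs.symm
  have irr : ∀ v, ¬ ord v v := hord.irrefl
  have d1 : ord .Y2 .Y1 := by
    rcases depends_of_ne (F.F .Y1 (t false)) (false, false) (false, true) false true (by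
      rw [key1, key1]
      intro e
      exact absurd (congrArg Prod.snd e : false = true) Bool.false_ne_true) with d | d
    · exact absurd (hdep _ _ d) (irr _)
    · exact hdep _ _ d
  have d2 : ord .Y1 .Y2 := by
    rcases depends_of_ne (F.F .Y2 (t false)) (false, false) (true, false) false true (by
      rw [key2, key2]
      intro e
      exact absurd (e : false = true) Bool.false_ne_true) with d | d
    · exact hdep _ _ d
    · exact absurd (hdep _ _ d) (irr _)
  exact irr _ (hord.trans _ _ _ d1 d2)

theorem FL_rec : FL.Recursive := by
  intro u
  refine ⟨fun a b => a < b, inferInstance, ?_⟩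
  rintro v w ⟨s, s', hz, hne⟩
  fin_cases v
  · exact absurd rfl hne
  · by_contra hc
    exact hne (hz 0 (by rintro rfl; exact hc (by decide)))
  · by_contra hc
    exact hne (hz 1 (by rintro rfl; exact hc (by decide)))

theorem FH_rec : FH.Recursive := by
  intro u
  refine ⟨fun a b => a = .Y1 ∧ b = .Y2,
    { irrefl := by rintro a ⟨h, h'⟩; simp [h] at h'
      trans := by rintro a b c ⟨h, h'⟩ ⟨h2, h3⟩; exact ⟨h, h3⟩ }, ?_⟩
  rintro v w ⟨s, s', hz, hne⟩
  cases v
  · exact absurd rfl hne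
  · refine ⟨?_, rfl⟩
    by_contra hc
    exact hne (congrArg Prod.fst (hz .Y1 (fun e => hc e.symm)))

theorem constr : Constructive τ := by
  refine ⟨![some .Y1, some .Y2, some .Y1], ?_, ?_⟩
  · intro y
    cases y
    · exact ⟨0, rfl⟩
    · exact ⟨1, rfl⟩
  · refine ⟨fun y => match y with
      | .Y1 => fun s => (s ⟨0, rfl⟩, s ⟨2, rfl⟩)
      | .Y2 => fun s => s ⟨1, rfl⟩, ?_⟩
    intro s y
    cases y <;> rfl

def lift (s : ∀ y : VH, RH y) : ∀ v : VL, RL v :=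
  ![(s .Y1).1, s .Y2, (s .Y1).2]

theorem τ_lift (s : ∀ y : VH, RH y) : τ (lift s) = s := by
  funext y; cases y <;> rfl

theorem rst (i) (hi : i ∈ IL) : τ '' Rst i = Rst (ω i) := by
  have hi' : (i 0).isSome = (i 2).isSome := hi
  ext s
  constructor
  · rintro ⟨x, hx, rfl⟩ y a hy
    cases y
    · have hy' : (match i 0, i 2 with
        | some a, some c => some (a, c)
        | _, _ => none) = some a := hy
      split at hy'
      · rename_i p q h0 h2
        have e0 := hx 0 _ h0
        have e2 := hx 2 _ h2
        have ea : (p, q) = a := Option.some.inj hy'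
        rw [← ea]
        show (x 0, x 2) = (p, q)
        rw [e0, e2]
      · cases hy'
    · exact hx 1 a hy
  · intro hs
    refine ⟨lift s, ?_, τ_lift s⟩
    have h1 : ∀ p q, i 0 = some p → i 2 = some q → s .Y1 = (p, q) := by
      intro p q h0 h2
      apply hs .Y1
      show (match i 0, i 2 with
        | some a, some c => some (a, c)
        | _, _ => none) = some (p, q)
      rw [h0, h2]
    intro v a hv
    fin_cases v
    · have hv' : i 0 = some a := hv
      rw [hv'] at hi'
      obtain ⟨q, hq⟩ := Option.isSome_iff_exists.mp hi'.symm
      exact congrArg Prod.fst (h1 a q hv' hq)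
    · exact hs .Y2 a hv
    · have hv' : i 2 = some a := hv
      rw [hv'] at hi'
      obtain ⟨q, hq⟩ := Option.isSome_iff_exists.mp hi'
      exact congrArg Prod.snd (h1 q a hq hv')

theorem IH_eq : IH = ω '' IL := by
  symm
  apply Set.eq_univ_of_forall
  intro j
  cases h : j .Y1 with
  | none =>
    refine ⟨![none, j .Y2, none], rfl, ?_⟩
    funext y
    cases y
    · exact h.symm
    · rfl
  | some p =>
    refine ⟨![some p.1, j .Y2, some p.2], rfl, ?_⟩
    funext y
    cases y
    · exact h.symm
    · rfl

/-- even for constructive `τ`, an approximate abstraction need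
not decompose as an approximation of an exact abstraction.  In the concrete
example above: `M_L` and `M_H` are recursive models with the stated
semantics, `τ` is constructive, `(M_H, I_H)` and `(M_L, I_L)` are
τ-consistent (with `ω` the induced map `ω_τ` on `I_L` and `I_H = ω_τ(I_L)`),
`(M_H, I_H)` is a τ-α-approximate abstraction of `(M_L, I_L)` for some `α`
(depending on the chosen metric `dH`), yet there is NO recursive causal model
`(M_H', I_H)` similar to `(M_H, I_H)` that is an exact τ-abstraction of
`(M_L, I_L)`. -/
theorem no_decomposition_as_approximation_of_abstraction
    (dH : (∀ y : VH, RH y) → (∀ y : VH, RH y) → ℝ)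
    (hd0 : ∀ a b, dH a b = 0 ↔ a = b)
    (hdsymm : ∀ a b, dH a b = dH b a)
    (hdtri : ∀ a b c, dH a c ≤ dH a b + dH b c) :
    FL.Recursive ∧ (∀ u i, IsSolution FL u i (ML u i)) ∧
    FH.Recursive ∧ (∀ u i, IsSolution FH u i (MH u i)) ∧
    Constructive τ ∧
    -- τ-consistency:
    Function.Surjective τ ∧
    (∀ i ∈ IL, τ '' Rst i = Rst (ω i)) ∧
    IH = ω '' IL ∧
    Fintype.card CtxH ≤ Fintype.card CtxL ∧
    -- (M_H, I_H) is a τ-α-approximate abstraction of (M_L, I_L) for some α: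
    (∃ α : ℝ, dTau dH τ ω IL ML MH ≤ α) ∧
    -- but no recursive model similar to (M_H, I_H) is an exact τ-abstraction:
    ¬ ∃ (FH' : SCM CtxH VH RH)
        (MH' : CtxH → Intervention VH RH → (∀ y : VH, RH y)),
          FH'.Recursive ∧
          (∀ u i, IsSolution FH' u i (MH' u i)) ∧
          ∃ τU : CtxL → CtxH, Function.Surjective τU ∧
            ∀ u : CtxL, ∀ i ∈ IL, τ (ML u i) = MH' (τU u) (ω i) := by
  refine ⟨FL_rec, ?_, FH_rec, ?_, constr, fun s => ⟨lift s, τ_lift s⟩, rst, IH_eq, le_rfl,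
    ⟨_, le_rfl⟩, no_exact⟩
  · intro u i v
    fin_cases v <;> rfl
  · intro u i v
    cases v <;> rfl


end Example12
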